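/- In the paced auction allocation model for the at-most-one setting, budget-feasible pacing multipliers are closed under pointwise maximum: if β and β' are both budget-feasible pacing multiplier vectors, then β⁺ defined by β⁺_i = max(β_i, β'_i) is also budget-feasible. -/

import Mathlib

open Finset

/-- `β` is a budget-feasible pacing multiplier (BFPM) vector for the paced
auction allocation in the at-most-one setting: there are an allocation `x` and
prices `p` (the `s j`-th highest bid) such that bids strictly above the price
win a full unit, bids strictly below win nothing, supply clears, and each
buyer's total payment (winners pay their bid `β i * v i j = p j + λ i j`)
is within budget. -/
def PacedBFPM {N M : ℕ} (v : Fin N → Fin M → ℝ) (s : Fin M → ℕ)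
    (B : Fin N → ℝ) (β : Fin N → ℝ) : Prop :=
  ∃ x : Fin N → Fin M → ℝ, ∃ p : Fin M → ℝ,
    (∀ i j, 0 ≤ x i j ∧ x i j ≤ 1) ∧
    (∀ j, 0 ≤ p j) ∧
    (∀ i j, p j < β i * v i j → x i j = 1) ∧
    (∀ i j, β i * v i j < p j → x i j = 0) ∧
    (∀ j, ∑ i, x i j = (s j : ℝ)) ∧
    (∀ i, ∑ j, x i j * (β i * v i j) ≤ B i)

/-- Trim an over-allocation `y` from the lowest bids until the supply `S` clears. -/
theorem trim_alloc {n : ℕ} (b y : Fin n → ℝ) (p S : ℝ) (hS : 0 ≤ S)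
    (hy : ∀ i, 0 ≤ y i) (hy1 : ∀ i, p < b i → y i = 1)
    (hsum : S ≤ ∑ i, if p ≤ b i then y i else 0) :
    ∃ (z : Fin n → ℝ) (q : ℝ), p ≤ q ∧ (∀ i, 0 ≤ z i ∧ z i ≤ y i) ∧
      (∀ i, q < b i → z i = 1) ∧ (∀ i, b i < q → z i = 0) ∧ ∑ i, z i = S := by
  classical
  let C : Finset ℝ := (insert p (univ.image b)).filter
    (fun q => p ≤ q ∧ S ≤ ∑ i, if q ≤ b i then y i else 0)
  have hC : C.Nonempty := ⟨p, by simp [C, hsum]⟩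
  obtain ⟨q, hq, hmax⟩ := C.exists_max_image id hC
  simp only [C, mem_filter] at hq
  obtain ⟨-, hpq, hqS⟩ := hq
  have hL : ∑ i, (if q < b i then y i else 0) ≤ S := by
    by_cases hne : (univ.filter (fun i => q < b i)).Nonempty
    · obtain ⟨k, hk, hkmin⟩ := exists_min_image _ b hne
      simp only [mem_filter, mem_univ, true_and] at hk hkmin
      by_contra hcon
      have he : ∀ i, (q < b i ↔ b k ≤ b i) :=
        fun i => ⟨hkmin i, fun h => lt_of_lt_of_le hk h⟩
      simp only [he] at hcon
      have hm : b k ∈ C := by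
        simp only [C, mem_filter]
        refine ⟨by simp, by linarith, by linarith⟩
      have := hmax _ hm
      simp only [id] at this
      linarith
    · have : ∀ i, ¬ q < b i := by
        intro i hi
        exact hne ⟨i, by simpa using hi⟩
      simpa [this] using hS
  set L := ∑ i, (if q < b i then y i else 0) with hLd
  set E := ∑ i, (if b i = q then y i else 0) with hEd
  have hLE : ∑ i, (if q ≤ b i then y i else 0) = L + E := by
    rw [hLd, hEd, ← sum_add_distrib]
    refine sum_congr rfl fun i _ => ?_
    rcases lt_trichotomy q (b i) with h | h | h
    · simp [h, h.le, h.ne']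
    · simp [h]
    · simp [h.ne, not_lt.2 h.le, not_le.2 h]
  rw [hLE] at hqS
  obtain ⟨t, ht0, ht1, ht⟩ : ∃ t : ℝ, 0 ≤ t ∧ t ≤ 1 ∧ L + t * E = S := by
    by_cases hE : E = 0
    · exact ⟨0, le_rfl, zero_le_one, by rw [hE] at hqS; linarith⟩
    · have hE' : 0 < E := lt_of_le_of_ne (by linarith) (Ne.symm hE)
      refine ⟨(S - L) / E, div_nonneg (by linarith) hE'.le,
        (div_le_one hE').2 (by linarith), ?_⟩
      field_simp
      ring
  refine ⟨fun i => (if q < b i then y i else 0) + t * (if b i = q then y i else 0), q, hpq,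
    ?_, ?_, ?_, ?_⟩
  · intro i
    have := hy i
    rcases lt_trichotomy q (b i) with h | h | h
    · simp [h, h.ne', this]
    · simp only [h, lt_irrefl, if_true, if_false, zero_add]
      exact ⟨mul_nonneg ht0 this, by nlinarith⟩
    · simp [h.ne, not_lt.2 h.le, this]
  · intro i h
    simp [h, h.ne', hy1 i (lt_of_le_of_lt hpq h)]
  · intro i h
    simp [h.ne, not_lt.2 h.le]
  · rw [sum_add_distrib, ← mul_sum]
    exact ht

/-- BFPMs are closed under pointwise maximum. -/
theorem stmt9 {N M : ℕ} (v : Fin N → Fin M → ℝ) (s : Fin M → ℕ)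
    (B : Fin N → ℝ) (β β' : Fin N → ℝ)
    (hv : ∀ i j, 0 < v i j) (hB : ∀ i, 0 < B i)
    (hβ : ∀ i, 0 < β i) (hβ' : ∀ i, 0 < β' i)
    (hs : ∀ j, s j ≤ N)
    (h1 : PacedBFPM v s B β) (h2 : PacedBFPM v s B β') :
    PacedBFPM v s B (fun i => max (β i) (β' i)) := by
  classical
  obtain ⟨x, p, hx, hp, hx1, hx0, hxs, hxB⟩ := h1
  obtain ⟨x', p', hx', hp', hx1', hx0', hxs', hxB'⟩ := h2
  let y : Fin N → Fin M → ℝ := fun i j => if β' i ≤ β i then x i j else x' i j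
  have hy : ∀ i j, 0 ≤ y i j ∧ y i j ≤ 1 := by
    intro i j
    simp only [y]
    split_ifs
    exacts [hx i j, hx' i j]
  have hm : ∀ i j, β i * v i j ≤ max (β i) (β' i) * v i j := fun i j =>
    mul_le_mul_of_nonneg_right (le_max_left _ _) (hv i j).le
  have hm' : ∀ i j, β' i * v i j ≤ max (β i) (β' i) * v i j := fun i j =>
    mul_le_mul_of_nonneg_right (le_max_right _ _) (hv i j).le
  have key : ∀ j, ∃ (z : Fin N → ℝ) (q : ℝ), max (p j) (p' j) ≤ q ∧
      (∀ i, 0 ≤ z i ∧ z i ≤ y i j) ∧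
      (∀ i, q < max (β i) (β' i) * v i j → z i = 1) ∧
      (∀ i, max (β i) (β' i) * v i j < q → z i = 0) ∧ ∑ i, z i = (s j : ℝ) := by
    intro j
    apply trim_alloc (fun i => max (β i) (β' i) * v i j) (fun i => y i j) _ _ (Nat.cast_nonneg _)
      (fun i => (hy i j).1)
    · intro i h
      simp only [y]
      split_ifs with hi
      · rw [max_eq_left hi] at h
        exact hx1 i j (lt_of_le_of_lt (le_max_left _ _) h)
      · rw [max_eq_right (not_le.1 hi).le] at h
        exact hx1' i j (lt_of_le_of_lt (le_max_right _ _) h)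
    · rcases le_or_gt (p' j) (p j) with hpp | hpp
      · rw [max_eq_left hpp, ← hxs j]
        refine sum_le_sum fun i _ => ?_
        by_cases hb : β i * v i j < p j
        · rw [hx0 i j hb]
          split_ifs
          exacts [(hy i j).1, le_rfl]
        · rw [if_pos (le_trans (not_lt.1 hb) (hm i j))]
          simp only [y]
          split_ifs with hi
          · exact le_rfl
          · have := mul_lt_mul_of_pos_right (not_le.1 hi) (hv i j)
            rw [hx1' i j (by linarith)]
            exact (hx i j).2
      · rw [max_eq_right hpp.le, ← hxs' j]
        refine sum_le_sum fun i _ => ?_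
        by_cases hb : β' i * v i j < p' j
        · rw [hx0' i j hb]
          split_ifs
          exacts [(hy i j).1, le_rfl]
        · rw [if_pos (le_trans (not_lt.1 hb) (hm' i j))]
          simp only [y]
          split_ifs with hi
          · have := mul_le_mul_of_nonneg_right hi (hv i j).le
            rw [hx1 i j (by linarith)]
            exact (hx' i j).2
          · exact le_rfl
  choose z q hq hz hz1 hz0 hzs using key
  refine ⟨fun i j => z j i, q, fun i j => ⟨(hz j i).1, (hz j i).2.trans (hy i j).2⟩,
    fun j => (hp j).trans ((le_max_left _ _).trans (hq j)), fun i j => hz1 j i,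
    fun i j => hz0 j i, hzs, fun i => ?_⟩
  have hle : ∑ j, z j i * (max (β i) (β' i) * v i j)
      ≤ ∑ j, y i j * (max (β i) (β' i) * v i j) :=
    sum_le_sum fun j _ => mul_le_mul_of_nonneg_right (hz j i).2
      ((mul_pos (hβ i) (hv i j)).le.trans (hm i j))
  refine hle.trans ?_
  by_cases hi : β' i ≤ β i
  · simpa [y, hi] using hxB i
  · simpa [y, hi, max_eq_right (not_le.1 hi).le] using hxB' i
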